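/- For all δ > 0 and every integer t ≥ 3 there exists m₀ = m₀(δ,t) such that the following holds for every δ-expander G on m ≥ m₀ vertices: suppose every vertex of G outside a set T has degree at most (log m)⁴ and |T| ≤ t; then for every vertex set W with T ⊆ W and |W| ≤ m^{1/3}, the graph G with W removed contains a vertex set S such that the induced subgraph is a γ-expanding ball for γ = δ/(5·(log log m)²), m^{1/5} ≤ |S| ≤ m^{1/4}, and every vertex of the induced subgraph on S has degree at most (log m)⁴. -/

import Mathlib

open Real

/-- Edge density `d(G) = |E(G)|/|V(G)|`. -/
noncomputable def density {V : Type*} (G : SimpleGraph V) : ℝ :=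
  G.edgeSet.ncard / Nat.card V

/-- External neighborhood `N(S)`: vertices outside `S` adjacent to some vertex of `S`. -/
def nbhd {V : Type*} (G : SimpleGraph V) (S : Set V) : Set V :=
  {v | v ∉ S ∧ ∃ u ∈ S, G.Adj u v}

/-- `G` contains a `K_t`-minor (branch sets are disjoint, nonempty, connected,
pairwise joined by an edge). -/
def HasKtMinor {V : Type*} (G : SimpleGraph V) (t : ℕ) : Prop :=
  ∃ P : Fin t → Set V,
    (∀ i, (P i).Nonempty) ∧
    (Pairwise (Function.onFun Disjoint P)) ∧
    (∀ i, (G.induce (P i)).Connected) ∧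
    (∀ i j : Fin t, i < j → ∃ u ∈ P i, ∃ v ∈ P j, G.Adj u v)

/-- `G` contains a `K_t`-minor of order at most `k`. -/
def HasKtMinorOfOrder {V : Type*} (G : SimpleGraph V) (t : ℕ) (k : ℝ) : Prop :=
  ∃ P : Fin t → Set V,
    (∀ i, (P i).Nonempty) ∧
    (Pairwise (Function.onFun Disjoint P)) ∧
    (∀ i, (G.induce (P i)).Connected) ∧
    (∀ i j : Fin t, i < j → ∃ u ∈ P i, ∃ v ∈ P j, G.Adj u v) ∧
    ((⋃ i, P i).ncard : ℝ) ≤ k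

/-- `c(t)`: the least `c` such that every graph of density at least `c` has a `K_t`-minor. -/
noncomputable def minorThreshold (t : ℕ) : ℝ :=
  sInf {c : ℝ | ∀ (n : ℕ) (G : SimpleGraph (Fin n)), density G ≥ c → HasKtMinor G t}

/-- `δ`-expander. -/
def IsDeltaExpander {V : Type*} (G : SimpleGraph V) (δ : ℝ) : Prop :=
  ∀ d : ℕ, (d : ℝ) ≤ logb 2 (logb 2 (Nat.card V)) - 1 →
    ∀ S : Set V, (S.ncard : ℝ) ≤ (Nat.card V : ℝ) / (2 : ℝ) ^ (2 ^ d : ℕ) →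
      ((nbhd G S).ncard : ℝ) ≥
        δ * 2 ^ d / (logb 2 (Nat.card V) * (logb 2 (logb 2 (Nat.card V))) ^ 2) * S.ncard

/-- `(δ, n)`-expander. -/
def IsDeltaNExpander {V : Type*} (G : SimpleGraph V) (δ : ℝ) (n : ℕ) : Prop :=
  ∀ d : ℕ, (d : ℝ) ≤ logb 2 (logb 2 (Nat.card V)) - 1 →
    ∀ S : Set V, (S.ncard : ℝ) ≤ (Nat.card V : ℝ) / (2 : ℝ) ^ (2 ^ d : ℕ) →
      ((nbhd G S).ncard : ℝ) ≥ δ * 2 ^ d / logb 2 n * S.ncard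

/-- `B_k(v)`: ball of radius `k` around the vertex `v`. -/
def gball {V : Type*} (G : SimpleGraph V) (v : V) (k : ℕ) : Set V :=
  {u | ∃ p : G.Walk v u, p.length ≤ k}

/-- `B_k(U)`: ball of radius `k` around the vertex set `U`. -/
def gballSet {V : Type*} (G : SimpleGraph V) (U : Set V) (k : ℕ) : Set V :=
  {v | ∃ u ∈ U, ∃ p : G.Walk u v, p.length ≤ k}

/-- A graph `H` is a `γ`-expanding ball: it is covered by a ball `B_k(v)` all of whose
intermediate balls expand by a factor `1 + γ`. -/
def GraphIsExpandingBall {V : Type*} (H : SimpleGraph V) (γ : ℝ) : Prop :=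
  ∃ (v : V) (k : ℕ), gball H v k = Set.univ ∧
    ∀ i : ℕ, 1 ≤ i → i + 1 ≤ k →
      ((gball H v (i + 1)).ncard : ℝ) ≥ (1 + γ) * (gball H v i).ncard

lemma gball_zero {V : Type*} (G : SimpleGraph V) (v : V) : gball G v 0 = {v} := by
  ext u
  constructor
  · rintro ⟨p, hp⟩
    exact (SimpleGraph.Walk.eq_of_length_eq_zero (Nat.le_zero.mp hp)).symm
  · rintro rfl
    exact ⟨SimpleGraph.Walk.nil, le_rfl⟩

lemma gball_succ {V : Type*} (G : SimpleGraph V) (v : V) (k : ℕ) :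
    gball G v (k + 1) = gball G v k ∪ nbhd G (gball G v k) := by
  ext u
  constructor
  · rintro ⟨p, hp⟩
    by_cases hu : u ∈ gball G v k
    · exact Or.inl hu
    refine Or.inr ⟨hu, ?_⟩
    cases hq : p.reverse with
    | nil => exact absurd ⟨SimpleGraph.Walk.nil, Nat.zero_le k⟩ hu
    | @cons _ w _ h q =>
      refine ⟨w, ⟨q.reverse, ?_⟩, h.symm⟩
      have := congrArg SimpleGraph.Walk.length hq
      simp only [SimpleGraph.Walk.length_reverse, SimpleGraph.Walk.length_cons] at this ⊢
      omega
  · rintro (⟨p, hp⟩ | ⟨-, w, ⟨p, hp⟩, h⟩)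
    · exact ⟨p, hp.trans k.le_succ⟩
    · exact ⟨p.concat h, by simpa using hp⟩

/-- The ball of radius `k` around `v` in the graph obtained from `G` by
deleting `U` (for `v ∉ U`). -/
def ballAvoiding {V : Type*} (G : SimpleGraph V) (U : Set V) (v : V) : ℕ → Set V
  | 0 => {v}
  | k + 1 => ballAvoiding G U v k ∪ (nbhd G (ballAvoiding G U v k) \ U)

section ballAvoiding

variable {V : Type*} (G : SimpleGraph V) (U : Set V) (v : V)

lemma ballAvoiding_mono : Monotone (ballAvoiding G U v) :=
  monotone_nat_of_le_succ fun _ => Set.subset_union_left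

lemma mem_ballAvoiding (k : ℕ) : v ∈ ballAvoiding G U v k :=
  ballAvoiding_mono G U v (Nat.zero_le k) rfl

lemma ballAvoiding_disjoint (hv : v ∉ U) (k : ℕ) : Disjoint (ballAvoiding G U v k) U := by
  induction k with
  | zero => exact Set.disjoint_singleton_left.mpr hv
  | succ k ih => exact ih.union_left Set.disjoint_sdiff_left

lemma gball_induce_ballAvoiding (hv : v ∉ U) (k i : ℕ) (hi : i ≤ k) :
    gball (G.induce (ballAvoiding G U v k)) ⟨v, mem_ballAvoiding G U v k⟩ i =
      Subtype.val ⁻¹' ballAvoiding G U v i := by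
  induction i with
  | zero =>
    rw [gball_zero]
    ext x
    simp [ballAvoiding, Subtype.ext_iff]
  | succ i ih =>
    rw [gball_succ, ih (by omega)]
    ext ⟨x, hx⟩
    have hxU : x ∉ U := Set.disjoint_left.mp (ballAvoiding_disjoint G U v hv k) hx
    simp only [ballAvoiding, nbhd, Set.mem_union, Set.mem_preimage, Set.mem_ofPred_eq,
      Set.mem_sdiff, hxU, not_false_eq_true, and_true]
    refine or_congr_right (and_congr_right fun _ => ⟨?_, ?_⟩)
    · rintro ⟨⟨u, _⟩, hu, h⟩
      exact ⟨u, hu, h⟩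
    · rintro ⟨u, hu, h⟩
      exact ⟨⟨u, ballAvoiding_mono G U v (by omega) hu⟩, hu, h⟩

lemma ncard_gball_induce_ballAvoiding (hv : v ∉ U) (k i : ℕ) (hi : i ≤ k) :
    (gball (G.induce (ballAvoiding G U v k)) ⟨v, mem_ballAvoiding G U v k⟩ i).ncard =
      (ballAvoiding G U v i).ncard := by
  rw [gball_induce_ballAvoiding G U v hv k i hi]
  refine Set.ncard_preimage_of_injective_subset_range Subtype.val_injective ?_
  rw [Subtype.range_coe]
  exact ballAvoiding_mono G U v hi

lemma graphIsExpandingBall_ballAvoiding (hv : v ∉ U) (k : ℕ) (γ : ℝ)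
    (h : ∀ i, 1 ≤ i → i < k →
      (1 + γ) * (ballAvoiding G U v i).ncard ≤ (ballAvoiding G U v (i + 1)).ncard) :
    GraphIsExpandingBall (G.induce (ballAvoiding G U v k)) γ := by
  refine ⟨⟨v, mem_ballAvoiding G U v k⟩, k, ?_, fun i hi hik => ?_⟩
  · rw [gball_induce_ballAvoiding G U v hv k k le_rfl]
    exact Subtype.coe_preimage_self _
  · rw [ncard_gball_induce_ballAvoiding G U v hv k i (by omega),
      ncard_gball_induce_ballAvoiding G U v hv k (i + 1) hik]
    exact h i hi hik

variable [Finite V]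

lemma ncard_ballAvoiding_succ (k : ℕ) :
    (ballAvoiding G U v (k + 1)).ncard =
      (ballAvoiding G U v k).ncard + (nbhd G (ballAvoiding G U v k) \ U).ncard :=
  Set.ncard_union_eq (Set.disjoint_left.mpr fun _ hx hx' => hx'.1.1 hx)

lemma ncard_nbhd_le (S : Set V) (D : ℝ)
    (h : ∀ u ∈ S, ((G.neighborSet u).ncard : ℝ) ≤ D) :
    ((nbhd G S).ncard : ℝ) ≤ D * S.ncard := by
  classical
  have hS := S.toFinite
  have hsub : nbhd G S ⊆ ⋃ u ∈ hS.toFinset, G.neighborSet u := by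
    rintro x ⟨-, u, hu, hux⟩
    simp only [Set.Finite.mem_toFinset, Set.mem_iUnion]
    exact ⟨u, hu, hux⟩
  have h1 : (nbhd G S).ncard ≤ ∑ u ∈ hS.toFinset, (G.neighborSet u).ncard :=
    (Set.ncard_le_ncard hsub (Set.toFinite _)).trans (Finset.set_ncard_biUnion_le _ _)
  calc ((nbhd G S).ncard : ℝ) ≤ ∑ u ∈ hS.toFinset, ((G.neighborSet u).ncard : ℝ) := by
        exact_mod_cast h1
    _ ≤ ∑ u ∈ hS.toFinset, D := Finset.sum_le_sum fun u hu => h u (hS.mem_toFinset.mp hu)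
    _ = D * S.ncard := by
        rw [Finset.sum_const, nsmul_eq_mul, Set.ncard_eq_toFinset_card S hS, mul_comm]

/-- Growing balls around `v` while avoiding `U`, one either reaches size `a` through expanding
balls, or finds a ball of size at most `b` with few outer neighbours outside `U`. -/
lemma exists_ballAvoiding_large_or_not_expanding (hv : v ∉ U) {γ D a b : ℝ} (hγ : 0 < γ)
    (ha : 1 ≤ a) (hD : 0 ≤ D) (hb : (1 + D) * a ≤ b)
    (hdeg : ∀ u, u ∉ U → ((G.neighborSet u).ncard : ℝ) ≤ D) :
    ∃ k, ((ballAvoiding G U v k).ncard : ℝ) ≤ b ∧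
      ((a ≤ (ballAvoiding G U v k).ncard ∧
          GraphIsExpandingBall (G.induce (ballAvoiding G U v k)) γ) ∨
        ((nbhd G (ballAvoiding G U v k) \ U).ncard : ℝ) ≤
          γ * (ballAvoiding G U v k).ncard) := by
  classical
  set B := ballAvoiding G U v with hB
  have hpos : ∀ k, (0 : ℝ) < (B k).ncard := fun k => by
    exact_mod_cast (Set.ncard_pos (Set.toFinite _)).mpr ⟨v, mem_ballAvoiding G U v k⟩
  have hsucc : ∀ k, ((B (k + 1)).ncard : ℝ) = (B k).ncard + (nbhd G (B k) \ U).ncard :=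
    fun k => by exact_mod_cast ncard_ballAvoiding_succ G U v k
  let P : ℕ → Prop := fun k =>
    a ≤ (B (k + 1)).ncard ∨ ((nbhd G (B (k + 1)) \ U).ncard : ℝ) ≤ γ * (B (k + 1)).ncard
  have hP : ∃ k, P k := by
    by_contra! hcon
    have hgrow : ∀ k, k ≤ (B (k + 1)).ncard := by
      intro k
      induction k with
      | zero => exact Nat.zero_le _
      | succ k ih =>
        have h1 := (not_or.mp (hcon k)).2
        have h2 := hsucc (k + 1)
        have h3 : (0 : ℝ) < γ * (B (k + 1)).ncard := mul_pos hγ (hpos _)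
        have h4 : ((B (k + 1)).ncard : ℝ) < (B (k + 1 + 1)).ncard := by linarith
        have h5 : (B (k + 1)).ncard < (B (k + 1 + 1)).ncard := by exact_mod_cast h4
        omega
    have := (hgrow (Nat.card V + 1)).trans (Set.ncard_le_card _)
    omega
  let j := Nat.find hP
  have hmin : ∀ i < j, ¬ P i := fun i hi => Nat.find_min hP hi
  have hprev : ((B j).ncard : ℝ) ≤ a := by
    rcases Nat.eq_zero_or_pos j with hj | hj
    · simpa [hj, hB, ballAvoiding] using ha
    · have := (not_or.mp (hmin (j - 1) (by omega))).1
      rw [Nat.sub_add_cancel hj] at this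
      exact (not_le.mp this).le
  have hnb : ((nbhd G (B j) \ U).ncard : ℝ) ≤ D * (B j).ncard := by
    refine le_trans ?_ (ncard_nbhd_le G (B j) D fun u hu =>
      hdeg u (Set.disjoint_left.mp (ballAvoiding_disjoint G U v hv j) hu))
    exact_mod_cast Set.ncard_le_ncard Set.sdiff_subset (Set.toFinite _)
  refine ⟨j + 1, ?_, ?_⟩
  · rw [hsucc]
    nlinarith [mul_le_mul_of_nonneg_left hprev (by linarith : 0 ≤ 1 + D)]
  · rcases Nat.find_spec hP with h | h
    · refine Or.inl ⟨h, graphIsExpandingBall_ballAvoiding G U v hv _ γ fun i hi hij => ?_⟩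
      have h1 := (not_or.mp (hmin (i - 1) (by omega))).2
      rw [Nat.sub_add_cancel hi] at h1
      have h2 := hsucc i
      change (1 + γ) * ((B i).ncard : ℝ) ≤ (B (i + 1)).ncard
      linarith
    · exact Or.inr h

end ballAvoiding

/-- If all sets `A` of size about `c` expand well outside `W`, then some expanding ball of
size between `a` and `b` avoids `W`. -/
lemma exists_expandingBall_avoiding {V : Type*} [Finite V] (G : SimpleGraph V) (W : Set V)
    {γ D a b c : ℝ} (hγ : 0 < γ) (ha : 1 ≤ a) (hD : 0 ≤ D) (hb : (1 + D) * a ≤ b) (hc : 0 ≤ c)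
    (hdeg : ∀ u, u ∉ W → ((G.neighborSet u).ncard : ℝ) ≤ D)
    (hcard : (W.ncard : ℝ) + c < Nat.card V)
    (hexp : ∀ A : Set V, c - b < A.ncard → (A.ncard : ℝ) ≤ c →
      γ * A.ncard < (nbhd G A \ W).ncard) :
    ∃ S : Set V, Disjoint S W ∧ GraphIsExpandingBall (G.induce S) γ ∧
      a ≤ S.ncard ∧ (S.ncard : ℝ) ≤ b := by
  let F : Set (Set V) := {A | (A.ncard : ℝ) ≤ c ∧ ((nbhd G A \ W).ncard : ℝ) ≤ γ * A.ncard}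
  have hF : F.Nonempty := ⟨∅, by simpa using hc, by simp [nbhd]⟩
  obtain ⟨A, ⟨hAc, hAn⟩, hmax⟩ := Set.exists_max_image F Set.ncard F.toFinite hF
  have hAb : (A.ncard : ℝ) ≤ c - b := by
    by_contra! h
    exact absurd (hexp A h hAc) hAn.not_gt
  obtain ⟨v, hv⟩ : ∃ v, v ∉ W ∪ A := by
    by_contra! h
    have h1 : Nat.card V ≤ W.ncard + A.ncard := by
      rw [← Set.ncard_univ, ← Set.eq_univ_of_forall h]
      exact Set.ncard_union_le W A
    have h2 : (Nat.card V : ℝ) ≤ W.ncard + A.ncard := by exact_mod_cast h1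
    linarith
  obtain ⟨k, hkb, ⟨hka, hk⟩ | hk⟩ := exists_ballAvoiding_large_or_not_expanding G (W ∪ A) v hv hγ
    ha hD hb fun u hu => hdeg u fun h => hu (Or.inl h)
  · exact ⟨_, (ballAvoiding_disjoint G _ v hv k).mono_right Set.subset_union_left, hk, hka, hkb⟩
  exfalso
  set B := ballAvoiding G (W ∪ A) v k
  have hdisj : Disjoint A B :=
    ((ballAvoiding_disjoint G _ v hv k).mono_right Set.subset_union_right).symm
  have hcardAB : (A ∪ B).ncard = A.ncard + B.ncard := Set.ncard_union_eq hdisj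
  have hBpos : 0 < B.ncard := (Set.ncard_pos (Set.toFinite _)).mpr ⟨v, mem_ballAvoiding G _ v k⟩
  have hsub : nbhd G (A ∪ B) \ W ⊆ (nbhd G A \ W) ∪ (nbhd G B \ (W ∪ A)) := by
    rintro x ⟨⟨hx, u, hu | hu, hux⟩, hxW⟩
    · exact Or.inl ⟨⟨fun h => hx (Or.inl h), u, hu, hux⟩, hxW⟩
    · exact Or.inr ⟨⟨fun h => hx (Or.inr h), u, hu, hux⟩,
        fun h => h.elim hxW fun h => hx (Or.inl h)⟩
  have hn : ((nbhd G (A ∪ B) \ W).ncard : ℝ) ≤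
      (nbhd G A \ W).ncard + (nbhd G B \ (W ∪ A)).ncard := by
    exact_mod_cast (Set.ncard_le_ncard hsub (Set.toFinite _)).trans (Set.ncard_union_le _ _)
  have hmem : A ∪ B ∈ F := by
    constructor <;> rw [hcardAB] <;> push_cast <;> linarith
  have := hmax _ hmem
  omega

/-- In a `δ`-expander, sets of at most `√m` vertices expand at the strongest available rate. -/
lemma IsDeltaExpander.le_ncard_nbhd {V : Type*} {G : SimpleGraph V} {δ : ℝ}
    (hG : IsDeltaExpander G δ) (hδ : 0 < δ) (hm : 4 ≤ Nat.card V) (S : Set V)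
    (hS : (S.ncard : ℝ) ≤ (Nat.card V : ℝ) ^ ((1 : ℝ) / 2)) :
    δ / (4 * (logb 2 (logb 2 (Nat.card V))) ^ 2) * S.ncard ≤ (nbhd G S).ncard := by
  set m := Nat.card V
  have hm' : (4 : ℝ) ≤ m := by exact_mod_cast hm
  set L := logb 2 (m : ℝ) with hL
  set l := logb 2 L with hl
  have hL2 : 2 ≤ L := by
    rw [hL, le_logb_iff_rpow_le one_lt_two (by linarith)]
    norm_num
    linarith
  have hl1 : 1 ≤ l := by
    rw [hl, le_logb_iff_rpow_le one_lt_two (by linarith)]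
    simpa using hL2
  have h2l : (2 : ℝ) ^ l = L := rpow_logb two_pos (by norm_num) (by linarith)
  have h2L : (2 : ℝ) ^ L = m := rpow_logb two_pos (by norm_num) (by linarith)
  set d := ⌊l - 1⌋₊ with hd
  have hdl : (d : ℝ) ≤ l - 1 := Nat.floor_le (by linarith)
  have hdu : l - 1 < d + 1 := Nat.lt_floor_add_one _
  have hup : (2 : ℝ) ^ d ≤ L / 2 := by
    rw [← rpow_natCast, ← h2l]
    calc (2 : ℝ) ^ (d : ℝ) ≤ 2 ^ (l - 1) := rpow_le_rpow_of_exponent_le one_le_two hdl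
      _ = 2 ^ l / 2 := by rw [rpow_sub two_pos, rpow_one]
  have hlow : L / 4 ≤ (2 : ℝ) ^ d := by
    rw [← rpow_natCast, ← h2l]
    calc (2 : ℝ) ^ l / 4 = 2 ^ (l - 2) := by rw [rpow_sub two_pos]; norm_num
      _ ≤ 2 ^ (d : ℝ) := rpow_le_rpow_of_exponent_le one_le_two (by linarith)
  have hpow : (2 : ℝ) ^ (2 ^ d : ℕ) ≤ (m : ℝ) ^ ((1 : ℝ) / 2) := by
    rw [← rpow_natCast, ← h2L, ← rpow_mul two_pos.le]
    refine rpow_le_rpow_of_exponent_le one_le_two ?_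
    push_cast
    linarith
  have hsize : (S.ncard : ℝ) ≤ m / (2 : ℝ) ^ (2 ^ d : ℕ) := by
    rw [le_div_iff₀ (by positivity)]
    calc (S.ncard : ℝ) * 2 ^ (2 ^ d : ℕ) ≤ (m : ℝ) ^ ((1 : ℝ) / 2) * (m : ℝ) ^ ((1 : ℝ) / 2) := by
          gcongr
      _ = m := by rw [← rpow_add (by linarith)]; norm_num
  refine le_trans ?_ (hG d hdl S hsize)
  refine mul_le_mul_of_nonneg_right ?_ (Nat.cast_nonneg _)
  rw [div_le_div_iff₀ (by positivity) (by positivity)]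
  have : 0 ≤ δ * l ^ 2 := by positivity
  nlinarith [mul_le_mul_of_nonneg_left hlow this]

open Filter Asymptotics in
/-- Fixed powers of logarithms are eventually dominated by fixed powers. -/
lemma eventually_mul_logb_pow_le (C : ℝ) (n : ℕ) {r : ℝ} (hr : 0 < r) :
    ∀ᶠ x : ℝ in atTop, C * (logb 2 x) ^ n ≤ x ^ r := by
  have h := (isLittleO_log_rpow_rpow_atTop (n : ℝ) hr).const_mul_left (C / (log 2) ^ n)
  filter_upwards [h.bound one_pos, eventually_ge_atTop 0] with x hx hx0
  rw [rpow_natCast, one_mul, norm_eq_abs, norm_eq_abs, abs_of_nonneg (rpow_nonneg hx0 r)] at hx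
  refine le_trans (le_of_eq ?_) ((le_abs_self _).trans hx)
  rw [logb, div_pow]
  ring

/-- The main step in the proof of Claim 3.5: in a large `δ`-expander in which all vertices
outside a set `T` of at most `t` vertices have degree at most `(log m)⁴`, after removing any
set `W ⊇ T` of at most `m^{1/3}` vertices one can still find a set `S` inducing a
`γ`-expanding ball with `m^{1/5} ≤ |S| ≤ m^{1/4}` and all degrees at most `(log m)⁴`. -/
theorem stmt_15 :
    ∀ δ : ℝ, 0 < δ → ∀ t : ℕ, 3 ≤ t → ∃ m₀ : ℕ,
      ∀ m : ℕ, m₀ ≤ m → ∀ G : SimpleGraph (Fin m), IsDeltaExpander G δ →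
        ∀ T : Set (Fin m), (T.ncard : ℝ) ≤ t →
          (∀ v : Fin m, v ∉ T → ((G.neighborSet v).ncard : ℝ) ≤ (logb 2 m) ^ 4) →
          ∀ W : Set (Fin m), T ⊆ W → (W.ncard : ℝ) ≤ (m : ℝ) ^ ((1 : ℝ) / 3) →
            ∃ S : Set (Fin m), Disjoint S W ∧
              GraphIsExpandingBall (G.induce S) (δ / (5 * (logb 2 (logb 2 m)) ^ 2)) ∧
              (m : ℝ) ^ ((1 : ℝ) / 5) ≤ (S.ncard : ℝ) ∧
              (S.ncard : ℝ) ≤ (m : ℝ) ^ ((1 : ℝ) / 4) ∧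
              ∀ x : S, (((G.induce S).neighborSet x).ncard : ℝ) ≤ (logb 2 m) ^ 4 := by
  intro δ hδ t _
  have hev := (((eventually_mul_logb_pow_le 2 4 (r := 1 / 20) (by norm_num)).and
    (eventually_mul_logb_pow_le (80 / δ) 2 (r := 1 / 6) (by norm_num))).and
    ((tendsto_rpow_atTop (y := 1 / 6) (by norm_num)).eventually_ge_atTop 4)).and
    (Filter.eventually_ge_atTop (4 : ℝ))
  obtain ⟨m₀, hm₀⟩ := Filter.eventually_atTop.mp (tendsto_natCast_atTop_atTop.eventually hev)
  refine ⟨m₀, fun m hm G hG T _ hdeg W hTW hW => ?_⟩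
  obtain ⟨⟨⟨h1, h2⟩, h3⟩, h4⟩ := hm₀ m hm
  set x : ℝ := (m : ℝ) with hx
  have hx0 : 0 < x := by linarith
  have hx1 : 1 ≤ x := by linarith
  set L := logb 2 x with hL
  have hL2 : 2 ≤ L := by
    rw [hL, le_logb_iff_rpow_le one_lt_two hx0]
    norm_num
    linarith
  have hl1 : 1 ≤ logb 2 L := by
    rw [le_logb_iff_rpow_le one_lt_two (by linarith)]
    simpa using hL2
  have hlL : logb 2 L ≤ L := by
    rw [logb_le_iff_le_rpow one_lt_two (by linarith), hL, rpow_logb two_pos (by norm_num) hx0]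
    rw [logb_le_iff_le_rpow one_lt_two hx0, hx, rpow_natCast]
    exact_mod_cast (Nat.lt_two_pow_self (n := m)).le
  set l := logb 2 L with hl
  have hl0 : 0 < l := by linarith
  have hsq : l ^ 2 ≤ L ^ 2 := by gcongr
  have e1 : x ^ ((1 : ℝ) / 20) * x ^ ((1 : ℝ) / 5) = x ^ ((1 : ℝ) / 4) := by
    rw [← rpow_add hx0]; norm_num
  have e2 : x ^ ((1 : ℝ) / 3) * x ^ ((1 : ℝ) / 6) = x ^ ((1 : ℝ) / 2) := by
    rw [← rpow_add hx0]; norm_num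
  have e3 : x ^ ((1 : ℝ) / 2) * x ^ ((1 : ℝ) / 2) = x := by
    rw [← rpow_add hx0]; norm_num
  have e4 : x ^ ((1 : ℝ) / 4) ≤ x ^ ((1 : ℝ) / 3) :=
    rpow_le_rpow_of_exponent_le hx1 (by norm_num)
  have h5 : 1 ≤ x ^ ((1 : ℝ) / 5) := one_le_rpow hx1 (by norm_num)
  have p3 : 1 ≤ x ^ ((1 : ℝ) / 3) := one_le_rpow hx1 (by norm_num)
  have p2 : 4 * x ^ ((1 : ℝ) / 3) ≤ x ^ ((1 : ℝ) / 2) := by nlinarith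
  have hγ : 0 < δ / (5 * l ^ 2) := by positivity
  have hL4 : 1 ≤ L ^ 4 := one_le_pow₀ (by linarith)
  have hm4 : 4 ≤ Nat.card (Fin m) := by
    rw [Nat.card_fin]
    rw [hx] at h4
    exact_mod_cast h4
  have hlarge : ∀ A : Set (Fin m), x ^ ((1 : ℝ) / 2) - x ^ ((1 : ℝ) / 4) < A.ncard →
      (A.ncard : ℝ) ≤ x ^ ((1 : ℝ) / 2) →
      δ / (5 * l ^ 2) * A.ncard < (nbhd G A \ W).ncard := by
    intro A hA hAc
    have hexp := hG.le_ncard_nbhd hδ hm4 A (by rwa [Nat.card_fin])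
    rw [Nat.card_fin, ← hx, ← hL, ← hl] at hexp
    have hsplit : ((nbhd G A).ncard : ℝ) ≤ (nbhd G A \ W).ncard + W.ncard := by
      exact_mod_cast Set.ncard_le_ncard_sdiff_add_ncard (nbhd G A) W
    have hgap : x ^ ((1 : ℝ) / 3) < δ / (20 * l ^ 2) * A.ncard := by
      have hAlow : x ^ ((1 : ℝ) / 2) / 2 < A.ncard := by linarith
      have hrate : 80 / δ * l ^ 2 ≤ x ^ ((1 : ℝ) / 6) := le_trans (by gcongr) h2
      have hr : 4 ≤ δ / (20 * l ^ 2) * x ^ ((1 : ℝ) / 6) := by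
        calc (4 : ℝ) = δ / (20 * l ^ 2) * (80 / δ * l ^ 2) := by field_simp; norm_num
          _ ≤ _ := by gcongr
      calc x ^ ((1 : ℝ) / 3) < x ^ ((1 : ℝ) / 3) * 4 / 2 := by linarith
        _ ≤ x ^ ((1 : ℝ) / 3) * (δ / (20 * l ^ 2) * x ^ ((1 : ℝ) / 6)) / 2 := by gcongr
        _ = δ / (20 * l ^ 2) * (x ^ ((1 : ℝ) / 2) / 2) := by rw [← e2]; ring
        _ < _ := by gcongr
    have hdiff : δ / (4 * l ^ 2) * (A.ncard : ℝ) =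
        δ / (5 * l ^ 2) * A.ncard + δ / (20 * l ^ 2) * A.ncard := by
      field_simp
      ring
    linarith
  obtain ⟨S, hSW, hball, hSa, hSb⟩ := exists_expandingBall_avoiding G W (γ := δ / (5 * l ^ 2))
    (D := L ^ 4) (a := x ^ ((1 : ℝ) / 5)) (b := x ^ ((1 : ℝ) / 4)) (c := x ^ ((1 : ℝ) / 2))
    hγ h5 (by positivity) (by rw [← e1]; gcongr; linarith) (by positivity)
    (fun u hu => hdeg u fun h => hu (hTW h)) (by rw [Nat.card_fin, ← hx]; nlinarith) hlarge
  refine ⟨S, hSW, hball, hSa, hSb, fun y => le_trans ?_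
    (hdeg y fun h => Set.disjoint_left.mp hSW y.2 (hTW h))⟩
  have : ((G.induce S).neighborSet y).ncard ≤ (G.neighborSet (y : Fin m)).ncard :=
    Set.ncard_le_ncard_of_injOn Subtype.val (fun _ h => h) Subtype.val_injective.injOn
      (Set.toFinite _)
  exact_mod_cast this
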